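/- For any rooted tree x with |x| = k+1 and any nonnegative integer a, Σ_{|t|=k+a+1} m(x;t)·n(•;t) = n(•;x) · Π_{i=2}^{a+1} C(k+i, 2), where the sum runs over isomorphism classes of rooted trees t with k+a+1 vertices and C(n,2) denotes the binomial coefficient. -/

import Mathlib

attribute [local instance] Classical.propDecidable

inductive PlanarTree : Type where
  | node : List PlanarTree → PlanarTree

namespace PlanarTree

/-- Isomorphism of (planar representatives of) rooted trees: the lists of
principal branches match up, pairwise isomorphically, after a permutation. -/
inductive Iso : PlanarTree → PlanarTree → Prop where
  | node {l m l' : List PlanarTree} :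
      List.Perm l m → List.Forall₂ Iso m l' → Iso (node l) (node l')

/-- Number of vertices. -/
def size : PlanarTree → ℕ
  | node l => 1 + (l.attach.map fun c => size c.1).sum
decreasing_by simp only [PlanarTree.node.sizeOf_spec]; exact Nat.lt_of_lt_of_le (List.sizeOf_lt_of_mem c.2) (Nat.le_add_left _ _)

mutual
  /-- All trees obtained by attaching the root of `s` by a new edge to some vertex. -/
  def graftList (s : PlanarTree) : PlanarTree → List PlanarTree
    | node l => node (s :: l) :: (graftAux s l).map node
  def graftAux (s : PlanarTree) : List PlanarTree → List (List PlanarTree)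
    | [] => []
    | a :: l => ((graftList s a).map (· :: l)) ++ (graftAux s l).map (a :: ·)
end

/-- All trees obtained by adding a new edge and terminal vertex at some vertex. -/
def growList (t : PlanarTree) : List PlanarTree := graftList (node []) t

mutual
  /-- All trees obtained by deleting one (non-root) terminal vertex. -/
  def pruneList : PlanarTree → List PlanarTree
    | node l => (pruneAux l).map node
  def pruneAux : List PlanarTree → List (List PlanarTree)
    | [] => []
    | a :: l =>
        (match a with | node [] => [l] | _ => []) ++
        ((pruneList a).map (· :: l)) ++ (pruneAux l).map (a :: ·)
end

mutual
  /-- All pairs (cut-off subtree, remaining tree) obtained by cutting one edge. -/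
  def cutPairs : PlanarTree → List (PlanarTree × PlanarTree)
    | node l => (cutAux l).map fun x => (x.1, node x.2)
  def cutAux : List PlanarTree → List (PlanarTree × List PlanarTree)
    | [] => []
    | a :: l =>
        (a, l) :: (((cutPairs a).map fun x => (x.1, x.2 :: l)) ++
          (cutAux l).map fun x => (x.1, a :: x.2))
end

/-- The order of the symmetry group `SG(t)`: the product over all vertices `v`
of the number of permutations of the branches at `v` exchanging isomorphic branches. -/
noncomputable def sg : PlanarTree → ℕ
  | node l =>
      (l.attach.map fun c => sg c.1).prod *
        Nat.card {σ : Equiv.Perm (Fin l.length) // ∀ i, Iso (l.get (σ i)) (l.get i)}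
decreasing_by simp only [PlanarTree.node.sizeOf_spec]; exact Nat.lt_of_lt_of_le (List.sizeOf_lt_of_mem c.2) (Nat.le_add_left _ _)

/-- Vertices of a planar tree, encoded as paths of child-indices from the root. -/
inductive IsVertex : PlanarTree → List ℕ → Prop where
  | root (t : PlanarTree) : IsVertex t []
  | child {l : List PlanarTree} {i : ℕ} {c : PlanarTree} {p : List ℕ} :
      l[i]? = some c → IsVertex c p → IsVertex (node l) (i :: p)

def Vertex (t : PlanarTree) : Type := {p : List ℕ // IsVertex t p}

/-- `v` lies strictly below `w` in the tree order (i.e. `w` is a proper ancestor of `v`). -/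
def StrictBelow {t : PlanarTree} (v w : Vertex t) : Prop := w.1 <+: v.1 ∧ w.1 ≠ v.1

/-- A labelling of `t`. -/
def Labelling (t : PlanarTree) : Type :=
  {f : Vertex t ≃ Fin t.size // ∀ v w, StrictBelow v w → f w < f v}

/-- Equivalence of labellings: they differ by an automorphism of the rooted tree. -/
def labelEquiv {t : PlanarTree} (f g : Labelling t) : Prop :=
  ∃ φ : Equiv.Perm (Vertex t),
    (∀ v w, StrictBelow (φ v) (φ w) ↔ StrictBelow v w) ∧ ∀ v, f.1 (φ v) = g.1 v

end PlanarTree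

/-- Rooted trees: isomorphism classes of planar rooted trees. -/
instance planarSetoid : Setoid PlanarTree := Relation.EqvGen.setoid PlanarTree.Iso

def RTree : Type := Quotient planarSetoid

namespace RTree

def mk (p : PlanarTree) : RTree := ⟦p⟧

/-- A chosen planar representative. -/
noncomputable def rep (T : RTree) : PlanarTree := Quotient.out T

noncomputable def size (T : RTree) : ℕ := T.rep.size

/-- The order of the symmetry (automorphism) group of `T`. -/
noncomputable def sg (T : RTree) : ℕ := T.rep.sg

/-- The one-vertex tree. -/
def bullet : RTree := mk (PlanarTree.node [])

/-- `Covers T T'` means `T ⊲ T'`: `T` is obtained from `T'` by deleting one terminal vertex. -/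
noncomputable def Covers (T T' : RTree) : Prop :=
  ∃ p ∈ T'.rep.pruneList, mk p = T

/-- `n(T;T')`: the number of vertices of `T` to which a new edge can be added to obtain `T'`. -/
noncomputable def nCov (T T' : RTree) : ℕ :=
  T.rep.growList.countP fun p => decide (mk p = T')

/-- `m(T;T')`: the number of (terminal) edges of `T'` which when removed leave `T`. -/
noncomputable def mCov (T T' : RTree) : ℕ :=
  T'.rep.pruneList.countP fun p => decide (mk p = T)

/-- `n(T₁,T₂;T₃)`: the number of vertices of `T₂` such that attaching the root of `T₁`
there by a new edge yields `T₃`. -/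
noncomputable def nTri (T₁ T₂ T₃ : RTree) : ℕ :=
  (PlanarTree.graftList T₁.rep T₂.rep).countP fun p => decide (mk p = T₃)

/-- `m(T₁,T₂;T₃)`: the number of edges of `T₃` whose removal cuts off a subtree
isomorphic to `T₁` leaving `T₂` (the piece containing the root). -/
noncomputable def mTri (T₁ T₂ T₃ : RTree) : ℕ :=
  T₃.rep.cutPairs.countP fun x => decide (mk x.1 = T₁ ∧ mk x.2 = T₂)

end RTree

section Ops

variable (k : Type*) [Semiring k]

/-- The element `𝔑(T) = Σ_{T ⊲ T'} n(T;T')·T'` of `k{T}`. -/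
noncomputable def growF (T : RTree) : RTree →₀ k :=
  (T.rep.growList.map fun p => Finsupp.single (RTree.mk p) (1 : k)).sum

/-- The element `𝔓(T) = Σ_{T' ⊲ T} m(T';T)·T'` of `k{T}`. -/
noncomputable def pruneF (T : RTree) : RTree →₀ k :=
  (T.rep.pruneList.map fun p => Finsupp.single (RTree.mk p) (1 : k)).sum

/-- The growth operator `𝔑` on `k{T}`. -/
noncomputable def Grow : Module.End k (RTree →₀ k) :=
  Finsupp.linearCombination k (growF k)

/-- The pruning operator `𝔓` on `k{T}`. -/
noncomputable def Prune : Module.End k (RTree →₀ k) :=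
  Finsupp.linearCombination k (pruneF k)

/-- The operator `𝔇` on `k{T}`, `𝔇(t) = |t|·t`. -/
noncomputable def Diag : Module.End k (RTree →₀ k) :=
  Finsupp.linearCombination k fun T => (T.size : k) • Finsupp.single T 1

/-- The inner product on `k{T}` determined by `(t,t') = |SG(t)|·δ_{t,t'}`. -/
noncomputable def innerT (x y : RTree →₀ k) : k :=
  x.sum fun T c => c * y T * (T.sg : k)

/-- Generalized multiplicity `n(T;T')`: coefficient of `T'` in `𝔑^{|T'|-|T|}(T)`. -/
noncomputable def nGen (T T' : RTree) : k :=
  ((Grow k ^ (T'.size - T.size)) (Finsupp.single T 1)) T'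

/-- Generalized multiplicity `m(T;T')`: coefficient of `T` in `𝔓^{|T'|-|T|}(T')`. -/
noncomputable def mGen (T T' : RTree) : k :=
  ((Prune k ^ (T'.size - T.size)) (Finsupp.single T' 1)) T

end Ops

section Kreimer

variable (k : Type*) [CommSemiring k]

/-- Kreimer's Hopf algebra `H_K`, as a commutative algebra: the free polynomial
algebra on rooted trees. -/
abbrev HK := MvPolynomial RTree k

/-- The inclusion `k{T} → H_K` of the linear span of the variables. -/
noncomputable def toHK : (RTree →₀ k) →ₗ[k] HK k :=
  Finsupp.linearCombination k fun T => MvPolynomial.X T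

/-- The growth derivation `N` on `H_K`, with `N(t) = 𝔑(t)` for rooted trees `t`. -/
noncomputable def ND : Derivation k (HK k) (HK k) :=
  MvPolynomial.mkDerivation k fun T => toHK k (growF k T)

/-- The pruning derivation `P` on `H_K`, with `P(t) = 𝔓(t)` for `|t| ≥ 2`, `P(•) = 1`. -/
noncomputable def PD : Derivation k (HK k) (HK k) :=
  MvPolynomial.mkDerivation k fun T =>
    if T = RTree.bullet then 1 else toHK k (pruneF k T)

/-- The grading derivation `D` on `H_K`, multiplying each homogeneous element of
degree `n` by `n`; it is the derivation with `D(t) = |t|·t` for rooted trees `t`. -/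
noncomputable def DD : Derivation k (HK k) (HK k) :=
  MvPolynomial.mkDerivation k fun T => (T.size : k) • MvPolynomial.X T

/-- The map `B₊ : H_K → k{T}` sending a forest to the tree obtained by attaching
all its roots to a new root vertex. -/
noncomputable def forestTree (d : RTree →₀ ℕ) : RTree :=
  RTree.mk (PlanarTree.node
    (d.support.toList.flatMap fun T => List.replicate (d T) T.rep))

noncomputable def Bplus (p : HK k) : RTree →₀ k :=
  ∑ d ∈ p.support, Finsupp.single (forestTree d) (MvPolynomial.coeff d p)

/-- The inner product on `H_K`. -/
noncomputable def innerHK (u v : HK k) : k := innerT k (Bplus k u) (Bplus k v)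

/-- The degree-`n` homogeneous component of `H_K`. -/
noncomputable abbrev HKcomp (n : ℕ) : Submodule k (HK k) :=
  MvPolynomial.weightedHomogeneousSubmodule k (fun T : RTree => T.size) n

/-- `T_i`: the number of rooted trees with `i+1` vertices. -/
noncomputable def Tcard (i : ℕ) : ℕ := Nat.card {T : RTree // T.size = i + 1}

end Kreimer

namespace PlanarTree

section Sums

variable {M : Type*} [AddCommMonoid M]

theorem size_node (l : List PlanarTree) : (node l).size = 1 + (l.map size).sum := by
  simp [size]

/-- The sum of `f` over all trees obtained from `t` by adding a terminal vertex. -/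
def growSum (f : PlanarTree → M) (t : PlanarTree) : M := ((growList t).map f).sum

/-- The sum of `f` over all forests obtained from `l` by adding a terminal vertex
below some vertex. -/
def growForestSum (f : List PlanarTree → M) (l : List PlanarTree) : M :=
  ((graftAux (node []) l).map f).sum

/-- The sum of `f` over all trees obtained from `t` by deleting a non-root terminal vertex. -/
def pruneSum (f : PlanarTree → M) (t : PlanarTree) : M := ((pruneList t).map f).sum

/-- The sum of `f` over all forests obtained from `l` by deleting a terminal vertex. -/
def pruneForestSum (f : List PlanarTree → M) (l : List PlanarTree) : M :=
  ((pruneAux l).map f).sum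

theorem growSum_node (f : PlanarTree → M) (l : List PlanarTree) :
    growSum f (node l) = f (node (node [] :: l)) + growForestSum (fun m => f (node m)) l := by
  simp [growSum, growForestSum, growList, graftList, Function.comp_def]

theorem growForestSum_nil (f : List PlanarTree → M) : growForestSum f [] = 0 := by
  simp [growForestSum, graftAux]

theorem growForestSum_cons (f : List PlanarTree → M) (a : PlanarTree) (l : List PlanarTree) :
    growForestSum f (a :: l) =
      growSum (fun b => f (b :: l)) a + growForestSum (fun m => f (a :: m)) l := by
  simp [growSum, growForestSum, growList, graftAux, Function.comp_def]

theorem pruneSum_node (f : PlanarTree → M) (l : List PlanarTree) :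
    pruneSum f (node l) = pruneForestSum (fun m => f (node m)) l := by
  simp [pruneSum, pruneForestSum, pruneList, Function.comp_def]

theorem pruneForestSum_nil (f : List PlanarTree → M) : pruneForestSum f [] = 0 := by
  simp [pruneForestSum, pruneAux]

theorem pruneForestSum_cons (f : List PlanarTree → M) (a : PlanarTree) (l : List PlanarTree) :
    pruneForestSum f (a :: l) =
      (if a = node [] then f l else 0) + pruneSum (fun b => f (b :: l)) a +
        pruneForestSum (fun m => f (a :: m)) l := by
  rcases a with ⟨_ | ⟨b, bs⟩⟩ <;>
    simp [pruneSum, pruneForestSum, pruneAux, Function.comp_def, add_assoc]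

theorem ne_of_mem_growList {p q : PlanarTree} (h : q ∈ growList p) : q ≠ node [] := by
  rcases p with ⟨l⟩
  simp only [growList, graftList, List.mem_cons, List.mem_map] at h
  rcases h with rfl | ⟨m, hm, rfl⟩
  · simp
  · rcases l with _ | ⟨a, l⟩
    · simp [graftAux] at hm
    · simp only [graftAux, List.mem_append, List.mem_map] at hm
      rcases hm with ⟨_, _, rfl⟩ | ⟨_, _, rfl⟩ <;> simp

theorem growSum_congr {f g : PlanarTree → M} (t : PlanarTree)
    (h : ∀ q, q ≠ node [] → f q = g q) : growSum f t = growSum g t := by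
  unfold growSum
  rw [List.map_congr_left fun q hq => h q (ne_of_mem_growList hq)]

theorem growSum_add (f g : PlanarTree → M) (t : PlanarTree) :
    growSum (fun q => f q + g q) t = growSum f t + growSum g t :=
  List.sum_map_add

theorem growForestSum_add (f g : List PlanarTree → M) (l : List PlanarTree) :
    growForestSum (fun q => f q + g q) l = growForestSum f l + growForestSum g l :=
  List.sum_map_add

theorem growForestSum_ite (c : Prop) [Decidable c] (f : List PlanarTree → M)
    (l : List PlanarTree) :
    growForestSum (fun q => if c then f q else 0) l = if c then growForestSum f l else 0 := by
  split_ifs <;> simp [growForestSum]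

theorem pruneForestSum_add (f g : List PlanarTree → M) (l : List PlanarTree) :
    pruneForestSum (fun q => f q + g q) l = pruneForestSum f l + pruneForestSum g l :=
  List.sum_map_add

theorem sum_map_sum_map_comm {α β : Type*} (f : α → β → M) (l : List α) (m : List β) :
    (l.map fun a => (m.map fun b => f a b).sum).sum =
      (m.map fun b => (l.map fun a => f a b).sum).sum := by
  induction l with
  | nil => simp
  | cons a l ih => simp [ih, List.sum_map_add]

theorem growSum_pruneForestSum_comm (f : PlanarTree → List PlanarTree → M)
    (t : PlanarTree) (l : List PlanarTree) :
    growSum (fun q => pruneForestSum (fun m => f q m) l) t =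
      pruneForestSum (fun m => growSum (fun q => f q m) t) l :=
  sum_map_sum_map_comm _ _ _

theorem growForestSum_pruneSum_comm (f : PlanarTree → List PlanarTree → M)
    (t : PlanarTree) (l : List PlanarTree) :
    growForestSum (fun m => pruneSum (fun q => f q m) t) l =
      pruneSum (fun q => growForestSum (fun m => f q m) l) t :=
  (sum_map_sum_map_comm _ _ _).symm

mutual
  theorem growSum_pruneSum (f : PlanarTree → M) : ∀ t : PlanarTree,
      growSum (pruneSum f) t = pruneSum (growSum f) t + t.size • f t
    | node l => by
      have ih := growForestSum_pruneForestSum (fun m => f (node m)) l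
      simp only [growSum_node, pruneSum_node, pruneForestSum_cons, size_node,
        pruneForestSum_add, pruneForestSum_nil, ih, if_true, add_smul, one_smul]
      abel
  theorem growForestSum_pruneForestSum (f : List PlanarTree → M) : ∀ l : List PlanarTree,
      growForestSum (pruneForestSum f) l =
        pruneForestSum (growForestSum f) l + (l.map size).sum • f l
    | [] => by simp [growForestSum_nil, pruneForestSum_nil]
    | a :: l => by
      have iha := growSum_pruneSum (fun b => f (b :: l)) a
      have ihl := growForestSum_pruneForestSum (fun m => f (a :: m)) l
      have hg : growSum (fun b => pruneForestSum f (b :: l)) a =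
          growSum (pruneSum fun b => f (b :: l)) a +
            growSum (fun b => pruneForestSum (fun m => f (b :: m)) l) a := by
        rw [← growSum_add]
        exact growSum_congr a fun q hq => by simp [pruneForestSum_cons, hq]
      rw [growForestSum_cons, hg, pruneForestSum_cons]
      have hp : (fun m => pruneForestSum f (a :: m)) = fun m =>
          (if a = node [] then f m else 0) + pruneSum (fun b => f (b :: m)) a +
            pruneForestSum (fun m => f (a :: m)) m := by
        funext m; rw [pruneForestSum_cons]
      have hq : (fun b => growForestSum f (b :: l)) = fun b =>
          growSum (fun b => f (b :: l)) b + growForestSum (fun m => f (b :: m)) l := by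
        funext m; rw [growForestSum_cons]
      have hr : (fun m => growForestSum f (a :: m)) = fun m =>
          growSum (fun b => f (b :: m)) a + growForestSum (fun m => f (a :: m)) m := by
        funext m; rw [growForestSum_cons]
      have hs : ∀ g h : PlanarTree → M,
          pruneSum (fun q => g q + h q) a = pruneSum g a + pruneSum h a :=
        fun _ _ => List.sum_map_add
      rw [hp, hq, hr, growForestSum_add, growForestSum_add, growForestSum_ite,
        growForestSum_pruneSum_comm, growSum_pruneForestSum_comm, pruneForestSum_add, hs,
        iha, ihl, List.map_cons, List.sum_cons, add_smul]
      abel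
end

end Sums

section Invariance

variable {M : Type*}

theorem induction_mem {C : PlanarTree → Prop}
    (h : ∀ l : List PlanarTree, (∀ a ∈ l, C a) → C (node l)) : ∀ t, C t
  | node l => h l fun a _ => induction_mem h a

theorem Iso.refl (t : PlanarTree) : Iso t t := by
  induction t using induction_mem with
  | h l ih => exact .node (.refl l) (List.forall₂_same.2 ih)

theorem Iso.eq_bullet_iff {a b : PlanarTree} (h : Iso a b) :
    a = PlanarTree.node [] ↔ b = PlanarTree.node [] := by
  rcases h with ⟨hp, hf⟩
  have h₁ := hp.length_eq
  have h₂ := hf.length_eq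
  simp only [PlanarTree.node.injEq, ← List.length_eq_zero_iff]
  omega

theorem size_eq_of_iso (t : PlanarTree) : ∀ s, Iso t s → t.size = s.size := by
  induction t using induction_mem with
  | h l ih =>
    rintro _ ⟨hp, hf⟩
    rename_i m l'
    rw [size_node, size_node, (hp.map size).sum_eq]
    have hm : ∀ a ∈ m, ∀ s, Iso a s → a.size = s.size := fun a ha => ih a (hp.mem_iff.2 ha)
    clear ih hp
    congr 1
    induction hf with
    | nil => rfl
    | cons h _ ihf =>
      simp only [List.forall_mem_cons] at hm
      simp [hm.1 _ h, ihf hm.2]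

/-- Invariance of a function on forests under isomorphism. -/
structure ForestInv (f : List PlanarTree → M) : Prop where
  perm {l m : List PlanarTree} : l.Perm m → f l = f m
  iso {l m : List PlanarTree} : List.Forall₂ Iso l m → f l = f m

theorem ForestInv.cons {f : List PlanarTree → M} (hf : ForestInv f) (a : PlanarTree) :
    ForestInv fun l => f (a :: l) :=
  ⟨fun h => hf.perm (h.cons a), fun h => hf.iso (.cons (Iso.refl a) h)⟩

theorem ForestInv.head {f : List PlanarTree → M} (hf : ForestInv f) (l : List PlanarTree)
    {a b : PlanarTree} (h : Iso a b) : f (a :: l) = f (b :: l) :=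
  hf.iso (.cons h (List.forall₂_same.2 fun t _ => Iso.refl t))

theorem forestInv_node {f : PlanarTree → M} (hf : ∀ p q, Iso p q → f p = f q) :
    ForestInv fun l => f (node l) :=
  ⟨fun h => hf _ _ (.node h (List.forall₂_same.2 fun t _ => Iso.refl t)),
    fun h => hf _ _ (.node (.refl _) h)⟩

variable [AddCommMonoid M]

theorem growForestSum_perm {l m : List PlanarTree} (h : l.Perm m) :
    ∀ {f : List PlanarTree → M}, ForestInv f → growForestSum f l = growForestSum f m := by
  induction h with
  | nil => intros; rfl
  | cons a h ih =>
    intro f hf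
    rw [growForestSum_cons, growForestSum_cons, ih (hf.cons a)]
    simp only [hf.perm (h.cons _)]
  | swap a b l =>
    intro f hf
    have h : ∀ x y m, f (x :: y :: m) = f (y :: x :: m) := fun x y m => hf.perm (.swap y x m)
    simp only [growForestSum_cons]
    rw [funext fun c => h b c l, funext fun c => h a c l, funext (h a b)]
    abel
  | trans _ _ ih₁ ih₂ => exact fun hf => (ih₁ hf).trans (ih₂ hf)

theorem growSum_eq_of_iso (t : PlanarTree) : ∀ (s : PlanarTree) (f : PlanarTree → M),
    (∀ p q, Iso p q → f p = f q) → Iso t s → growSum f t = growSum f s := by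
  induction t using induction_mem with
  | h l ih =>
    rintro s f hf h
    have hroot : ∀ l l', Iso (node l) (node l') →
        f (node (node [] :: l)) = f (node (node [] :: l')) := by
      rintro _ _ ⟨hp, hi⟩
      exact hf _ _ (.node (hp.cons _) (.cons (Iso.refl _) hi))
    rcases h with ⟨hp, hi⟩
    rename_i m l'
    rw [growSum_node, growSum_node, hroot _ _ (.node hp hi),
      growForestSum_perm hp (forestInv_node hf)]
    have hm := fun a ha => ih a (hp.mem_iff.2 ha)
    have hF := forestInv_node hf
    congr 1
    generalize (fun m => f (node m)) = F at hF
    clear ih hp hroot hf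
    induction hi generalizing F with
    | nil => rfl
    | @cons a b l₁ l₂ h hi ihf =>
      simp only [List.forall_mem_cons] at hm
      rw [growForestSum_cons, growForestSum_cons, ihf hm.2 _ (hF.cons a),
        hm.1 b _ (fun _ _ h => hF.head _ h) h]
      simp only [hF.head _ h, hF.iso (.cons (Iso.refl _) hi)]

theorem pruneForestSum_perm {l m : List PlanarTree} (h : l.Perm m) :
    ∀ {f : List PlanarTree → M}, ForestInv f → pruneForestSum f l = pruneForestSum f m := by
  induction h with
  | nil => intros; rfl
  | cons a h ih =>
    intro f hf
    rw [pruneForestSum_cons, pruneForestSum_cons, ih (hf.cons a), hf.perm h]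
    simp only [hf.perm (h.cons _)]
  | swap a b l =>
    intro f hf
    have h : ∀ x y m, f (x :: y :: m) = f (y :: x :: m) := fun x y m => hf.perm (.swap y x m)
    simp only [pruneForestSum_cons]
    rw [funext fun c => h b c l, funext fun c => h a c l, funext (h a b)]
    split_ifs with h₁ h₂ h₂ <;> simp only [*] <;> abel
  | trans _ _ ih₁ ih₂ => exact fun hf => (ih₁ hf).trans (ih₂ hf)

theorem pruneSum_eq_of_iso (t : PlanarTree) : ∀ (s : PlanarTree) (f : PlanarTree → M),
    (∀ p q, Iso p q → f p = f q) → Iso t s → pruneSum f t = pruneSum f s := by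
  induction t using induction_mem with
  | h l ih =>
    rintro _ f hf ⟨hp, hi⟩
    rename_i m l'
    rw [pruneSum_node, pruneSum_node, pruneForestSum_perm hp (forestInv_node hf)]
    have hm := fun a ha => ih a (hp.mem_iff.2 ha)
    have hF := forestInv_node hf
    generalize (fun m => f (node m)) = F at hF
    clear ih hp hf
    induction hi generalizing F with
    | nil => rfl
    | @cons a b l₁ l₂ h hi ihf =>
      simp only [List.forall_mem_cons] at hm
      rw [pruneForestSum_cons, pruneForestSum_cons, ihf hm.2 _ (hF.cons a),
        hm.1 b _ (fun _ _ h => hF.head _ h) h]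
      simp only [hF.head _ h, hF.iso (.cons (Iso.refl _) hi), hF.iso hi, h.eq_bullet_iff]

end Invariance

theorem size_of_mem_growList (t : PlanarTree) : ∀ q ∈ growList t, q.size = t.size + 1 := by
  induction t using induction_mem with
  | h l ih =>
    have key : ∀ m ∈ graftAux (node []) l, (m.map size).sum = (l.map size).sum + 1 := by
      induction l with
      | nil => simp [graftAux]
      | cons a l ihl =>
        simp only [List.forall_mem_cons] at ih
        intro m hm
        simp only [graftAux, List.mem_append, List.mem_map] at hm
        rcases hm with ⟨q, hq, rfl⟩ | ⟨q, hq, rfl⟩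
        · have := ih.1 q hq
          simp only [List.map_cons, List.sum_cons]
          omega
        · have := ihl ih.2 q hq
          simp only [List.map_cons, List.sum_cons]
          omega
    intro q hq
    simp only [growList, graftList, List.mem_cons, List.mem_map] at hq
    rcases hq with rfl | ⟨m, hm, rfl⟩
    · simp only [size_node, List.map_cons, List.map_nil, List.sum_cons, List.sum_nil]
      omega
    · have := key m hm
      simp only [size_node]
      omega

end PlanarTree

namespace RTree

open PlanarTree

theorem eq_of_mk_eq {α : Type*} {f : PlanarTree → α} (hf : ∀ p q, Iso p q → f p = f q)
    {p q : PlanarTree} (h : mk p = mk q) : f p = f q := by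
  have h' : Relation.EqvGen Iso p q := Quotient.exact h
  clear h
  induction h' with
  | rel _ _ h => exact hf _ _ h
  | refl => rfl
  | symm _ _ _ ih => exact ih.symm
  | trans _ _ _ _ _ ih₁ ih₂ => exact ih₁.trans ih₂

theorem mk_rep (T : RTree) : mk T.rep = T := Quotient.out_eq T

theorem mk_eq_of_iso {p q : PlanarTree} (h : Iso p q) : mk p = mk q :=
  Quotient.sound (.rel _ _ h)

theorem size_mk (p : PlanarTree) : (mk p).size = p.size :=
  eq_of_mk_eq size_eq_of_iso (mk_rep (mk p))

theorem size_bullet : bullet.size = 1 := by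
  rw [bullet, size_mk, size_node]
  rfl

end RTree

section Operators

open PlanarTree RTree

variable (k : Type*) [Field k]

theorem growF_mk (p : PlanarTree) :
    growF k (mk p) = growSum (fun q => Finsupp.single (mk q) (1 : k)) p :=
  eq_of_mk_eq (fun p q => growSum_eq_of_iso p q _ fun _ _ h => by rw [mk_eq_of_iso h])
    (mk_rep (mk p))

theorem pruneF_mk (p : PlanarTree) :
    pruneF k (mk p) = pruneSum (fun q => Finsupp.single (mk q) (1 : k)) p :=
  eq_of_mk_eq (fun p q => pruneSum_eq_of_iso p q _ fun _ _ h => by rw [mk_eq_of_iso h])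
    (mk_rep (mk p))

theorem Grow_single (p : PlanarTree) :
    Grow k (Finsupp.single (mk p) 1) = growSum (fun q => Finsupp.single (mk q) (1 : k)) p := by
  simp [Grow, growF_mk]

theorem Prune_single (p : PlanarTree) :
    Prune k (Finsupp.single (mk p) 1) =
      pruneSum (fun q => Finsupp.single (mk q) (1 : k)) p := by
  simp [Prune, pruneF_mk]

theorem Diag_single (p : PlanarTree) :
    Diag k (Finsupp.single (mk p) 1) = (p.size : k) • Finsupp.single (mk p) (1 : k) := by
  simp [Diag, size_mk]

theorem end_ext {A B : Module.End k (RTree →₀ k)}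
    (h : ∀ p, A (Finsupp.single (mk p) 1) = B (Finsupp.single (mk p) 1)) : A = B := by
  refine Finsupp.lhom_ext' fun T => LinearMap.ext_ring ?_
  have := h T.rep
  rwa [mk_rep] at this

theorem map_growSum {M N : Type*} [AddCommMonoid M] [AddCommMonoid N] [Module k M] [Module k N]
    (A : M →ₗ[k] N) (f : PlanarTree → M) (p : PlanarTree) :
    A (growSum f p) = growSum (fun q => A (f q)) p := by
  simp [growSum, map_list_sum, Function.comp_def]

theorem map_pruneSum {M N : Type*} [AddCommMonoid M] [AddCommMonoid N] [Module k M]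
    [Module k N] (A : M →ₗ[k] N) (f : PlanarTree → M) (p : PlanarTree) :
    A (pruneSum f p) = pruneSum (fun q => A (f q)) p := by
  simp [pruneSum, map_list_sum, Function.comp_def]

/-- The commutation relation `[𝔓, 𝔑] = 𝔇`. -/
theorem Prune_mul_Grow : Prune k * Grow k = Grow k * Prune k + Diag k := by
  refine end_ext k fun p => ?_
  simp only [Module.End.mul_apply, LinearMap.add_apply, Grow_single, Prune_single, Diag_single,
    map_growSum, map_pruneSum]
  rw [Nat.cast_smul_eq_nsmul]
  exact growSum_pruneSum _ p

theorem Diag_mul_Grow : Diag k * Grow k = Grow k * Diag k + Grow k := by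
  refine end_ext k fun p => ?_
  simp only [Module.End.mul_apply, LinearMap.add_apply, Grow_single, Diag_single,
    map_growSum, map_smul]
  unfold growSum
  rw [List.map_congr_left (g := fun q => ((p.size : k) + 1) • Finsupp.single (mk q) (1 : k))
    fun q hq => by rw [size_of_mem_growList p q hq, Nat.cast_add, Nat.cast_one]]
  rw [← Function.comp_def (fun v : RTree →₀ k => ((p.size : k) + 1) • v), ← List.map_map,
    ← List.smul_sum, add_smul, one_smul]

theorem Diag_apply (v : RTree →₀ k) (T : RTree) : Diag k v T = (T.size : k) * v T := by
  induction v using Finsupp.induction_linear with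
  | zero => simp
  | add f g hf hg => simp [hf, hg, mul_add]
  | single S c =>
    by_cases h : S = T
    · subst h; simp [Diag, mul_comm]
    · simp [Diag, h]

theorem Diag_Grow_pow (m : ℕ) :
    Diag k ((Grow k ^ m) (Finsupp.single bullet 1)) =
      ((m : k) + 1) • (Grow k ^ m) (Finsupp.single bullet 1) := by
  induction m with
  | zero => simp [Diag, size_bullet]
  | succ m ih =>
    rw [pow_succ', ← Module.End.mul_apply, ← mul_assoc, Diag_mul_Grow]
    simp only [Module.End.mul_apply, LinearMap.add_apply, ih, map_smul, add_mul]
    push_cast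
    module

theorem Prune_Grow_pow (m : ℕ) :
    Prune k ((Grow k ^ (m + 1)) (Finsupp.single bullet 1)) =
      (((m + 2).choose 2 : ℕ) : k) • (Grow k ^ m) (Finsupp.single bullet 1) := by
  have step : ∀ j : ℕ, Prune k ((Grow k ^ (j + 1)) (Finsupp.single bullet 1)) =
      Grow k (Prune k ((Grow k ^ j) (Finsupp.single bullet 1))) +
        ((j : k) + 1) • (Grow k ^ j) (Finsupp.single bullet 1) := fun j => by
    rw [pow_succ', ← Module.End.mul_apply, ← mul_assoc, Prune_mul_Grow, ← Diag_Grow_pow]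
    simp [add_mul]
  induction m with
  | zero =>
    rw [step]
    simp [bullet, Prune_single, pruneSum_node, pruneForestSum_nil]
  | succ m ih =>
    rw [step, ih, map_smul, ← Module.End.mul_apply, ← pow_succ', ← add_smul,
      Nat.choose_succ_succ' (m + 2) 1]
    congr 1
    push_cast [Nat.choose_one_right]
    ring

theorem Prune_pow_Grow_pow (n a : ℕ) :
    (Prune k ^ a) ((Grow k ^ (n + a)) (Finsupp.single bullet 1)) =
      (∏ i ∈ Finset.Icc 2 (a + 1), (((n + i).choose 2 : ℕ) : k)) •
        (Grow k ^ n) (Finsupp.single bullet 1) := by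
  induction a with
  | zero => simp
  | succ a ih =>
    rw [pow_succ, Module.End.mul_apply, ← add_assoc, Prune_Grow_pow, map_smul, ih, smul_smul,
      Finset.prod_Icc_succ_top (b := a + 1) (by omega), mul_comm]
    rfl

end Operators

/-- For `|x| = n+1` and `a ≥ 0`,
`Σ_{|t|=n+a+1} m(x;t)·n(•;t) = n(•;x)·Π_{i=2}^{a+1} C(n+i,2)`. -/
theorem stmt10 (k : Type*) [Field k] [CharZero k] (x : RTree) (n a : ℕ) (hx : x.size = n + 1) :
    (∑ᶠ t ∈ {t : RTree | RTree.size t = n + a + 1}, mGen k x t * nGen k RTree.bullet t)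
      = nGen k RTree.bullet x * ∏ i ∈ Finset.Icc 2 (a + 1), (((n + i).choose 2 : ℕ) : k) := by
  have hn (t : RTree) (m : ℕ) (ht : t.size = m + 1) : nGen k RTree.bullet t =
      (Grow k ^ m) (Finsupp.single RTree.bullet 1) t := by
    rw [nGen, RTree.size_bullet, ht, Nat.add_sub_cancel]
  rw [hn x n hx]
  set v := (Grow k ^ (n + a)) (Finsupp.single RTree.bullet 1) with hv
  have hsupp : ∀ t, v t ≠ 0 → t.size = n + a + 1 := fun t ht => by
    have h := congrArg (fun w => w t) (Diag_Grow_pow k (n + a))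
    simp only [← hv, Diag_apply, Finsupp.smul_apply, smul_eq_mul] at h
    exact_mod_cast mul_right_cancel₀ ht h
  have hterm : ∀ t ∈ {t : RTree | t.size = n + a + 1},
      mGen k x t * nGen k RTree.bullet t = ((Prune k ^ a) (Finsupp.single t 1)) x * v t := by
    intro t ht
    have ha : n + a + 1 - (n + 1) = a := by omega
    rw [hn t (n + a) ht, mGen, hx, show t.size = n + a + 1 from ht, ha]
  rw [finsum_mem_congr rfl hterm, finsum_mem_eq_sum_of_inter_support_eq (t := v.support)]
  · calc ∑ t ∈ v.support, ((Prune k ^ a) (Finsupp.single t 1)) x * v t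
        = ((Prune k ^ a) v) x := by
          conv_rhs => rw [← Finsupp.sum_single v]
          simp only [Finsupp.sum, map_sum, Finsupp.finsetSum_apply]
          refine Finset.sum_congr rfl fun t _ => ?_
          rw [← mul_one (v t), ← smul_eq_mul (v t) 1, ← Finsupp.smul_single, map_smul]
          simp [mul_comm]
      _ = _ := by
          rw [hv, Prune_pow_Grow_pow, Finsupp.smul_apply, smul_eq_mul, mul_comm]
  · ext t
    simp only [Set.mem_inter_iff, Set.mem_ofPred_eq, Function.mem_support, Finset.mem_coe,
      Finsupp.mem_support_iff]
    exact ⟨fun h => ⟨right_ne_zero_of_mul h.2, h.2⟩,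
      fun h => ⟨hsupp t h.1, h.2⟩⟩
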